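/- A right-linear overlay term rewrite system is terminating if and only if it is innermost terminating. -/

import Mathlib

namespace RWS

/-- First-order terms over a signature `F` (function symbols of arbitrary arity,
realized by lists of arguments) and variables `V`. -/
inductive Term (F V : Type) : Type
  | var : V → Term F V
  | app : F → List (Term F V) → Term F V

namespace Term

variable {F V : Type}

/-- `t` is a variable. -/
def IsVar : Term F V → Prop
  | var _ => True
  | app _ _ => False

/-- Application of a substitution (a map from variables to terms) to a term. -/
def subst (σ : V → Term F V) : Term F V → Term F V
  | var x => σ x
  | app f ts => app f (ts.attach.map fun t => t.1.subst σ)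
decreasing_by
  simp_wf
  have := List.sizeOf_lt_of_mem t.2
  omega

/-- The list of variable occurrences of a term. -/
def varOccs : Term F V → List V
  | var x => [x]
  | app _ ts => (ts.attach.map fun t => t.1.varOccs).flatten
decreasing_by
  simp_wf
  have := List.sizeOf_lt_of_mem t.2
  omega

/-- A term is linear if no variable occurs in it more than once. -/
def Linear (t : Term F V) : Prop := t.varOccs.Nodup

end Term

variable {F V : Type}

/-- `PSub t u` : `t` is a proper subterm of `u` (i.e. `u ▷ t`). -/
inductive PSub : Term F V → Term F V → Prop
  | head {t f ts} : t ∈ ts → PSub t (.app f ts)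
  | tail {t u f ts} : PSub t u → u ∈ ts → PSub t (.app f ts)

/-- Subterm-or-equal relation. -/
def Sub (t u : Term F V) : Prop := t = u ∨ PSub t u

/-- The rewrite relation of a set `R` of rewrite rules: contraction of a redex
at some position (root rule instance, closed under contexts). -/
inductive Rew (R : Set (Term F V × Term F V)) : Term F V → Term F V → Prop
  | root {l r : Term F V} {σ : V → Term F V} :
      (l, r) ∈ R → Rew R (l.subst σ) (r.subst σ)
  | congr {s t : Term F V} {f : F} {ts us : List (Term F V)} :
      Rew R s t → Rew R (.app f (ts ++ s :: us)) (.app f (ts ++ t :: us))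

/-- `t` is a normal form of `R`. -/
def NormalForm (R : Set (Term F V × Term F V)) (t : Term F V) : Prop :=
  ∀ u, ¬ Rew R t u

/-- Innermost rewriting: contraction of a redex all of whose proper subterms
are normal forms of `R`. -/
inductive IRew (R : Set (Term F V × Term F V)) : Term F V → Term F V → Prop
  | root {l r : Term F V} {σ : V → Term F V} :
      (l, r) ∈ R → (∀ u, PSub u (l.subst σ) → NormalForm R u) →
      IRew R (l.subst σ) (r.subst σ)
  | congr {s t : Term F V} {f : F} {ts us : List (Term F V)} :
      IRew R s t → IRew R (.app f (ts ++ s :: us)) (.app f (ts ++ t :: us))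

/-- A rewrite step at the root position (`→_{ε}`). -/
def RootStep (R : Set (Term F V × Term F V)) (s t : Term F V) : Prop :=
  ∃ l r σ, (l, r) ∈ R ∧ s = Term.subst σ l ∧ t = Term.subst σ r

/-- A rewrite step strictly below the root (`→_{>ε}`). -/
def BelowRew (R : Set (Term F V × Term F V)) (s t : Term F V) : Prop :=
  ∃ (f : F) (ts us : List (Term F V)) (a b : Term F V),
    Rew R a b ∧ s = .app f (ts ++ a :: us) ∧ t = .app f (ts ++ b :: us)

/-- An innermost rewrite step strictly below the root (`i→_{>ε}`). -/
def IBelowRew (R : Set (Term F V × Term F V)) (s t : Term F V) : Prop :=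
  ∃ (f : F) (ts us : List (Term F V)) (a b : Term F V),
    IRew R a b ∧ s = .app f (ts ++ a :: us) ∧ t = .app f (ts ++ b :: us)

/-- `R` is a term rewrite system: left-hand sides are not variables and
variables of right-hand sides occur in the corresponding left-hand sides. -/
def IsTRS (R : Set (Term F V × Term F V)) : Prop :=
  ∀ p ∈ R, ¬ p.1.IsVar ∧ ∀ x ∈ p.2.varOccs, x ∈ p.1.varOccs

/-- All right-hand sides are linear. -/
def RightLinear (R : Set (Term F V × Term F V)) : Prop :=
  ∀ p ∈ R, p.2.Linear

/-- No right-hand side is a variable. -/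
def NonCollapsing (R : Set (Term F V × Term F V)) : Prop :=
  ∀ p ∈ R, ¬ p.2.IsVar

/-- `R` has an inner-overlap: a proper non-variable subterm of some left-hand
side is unifiable (after renaming the rules apart, equivalently: some instance
of the one equals some instance of the other) with some left-hand side. -/
def InnerOverlap (R : Set (Term F V × Term F V)) : Prop :=
  ∃ l r l' r' u, (l, r) ∈ R ∧ (l', r') ∈ R ∧ PSub u l ∧ ¬ u.IsVar ∧
    ∃ σ τ : V → Term F V, u.subst σ = l'.subst τ

/-- `R` is an overlay system. -/
def Overlay (R : Set (Term F V × Term F V)) : Prop := ¬ InnerOverlap R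

/-- The term `t` is terminating w.r.t. `R`: no infinite rewrite sequence starts from `t`. -/
def Terminating (R : Set (Term F V × Term F V)) (t : Term F V) : Prop :=
  ¬ ∃ f : ℕ → Term F V, f 0 = t ∧ ∀ n, Rew R (f n) (f (n + 1))

/-- The TRS `R` is terminating: there is no infinite rewrite sequence. -/
def TerminatingTRS (R : Set (Term F V × Term F V)) : Prop :=
  ¬ ∃ f : ℕ → Term F V, ∀ n, Rew R (f n) (f (n + 1))

/-- The TRS `R` is innermost terminating: there is no infinite innermost rewrite sequence. -/
def InnermostTerminatingTRS (R : Set (Term F V × Term F V)) : Prop :=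
  ¬ ∃ f : ℕ → Term F V, ∀ n, IRew R (f n) (f (n + 1))

/-- Domain of a substitution. -/
def Dom (σ : V → Term F V) : Set V := {x | σ x ≠ .var x}

end RWS

namespace RWS

variable {F V : Type}

/-- Embedding of terms over the signature `F` into terms over the extended
signature `F ⊕ F`, where `Sum.inl f` is the original symbol `f` and
`Sum.inr f` is the fresh tuple symbol `f#`. -/
def Term.lift : Term F V → Term (F ⊕ F) V
  | .var x => .var x
  | .app f ts => .app (Sum.inl f) (ts.attach.map fun t => t.1.lift)
decreasing_by
  simp_wf
  have := List.sizeOf_lt_of_mem t.2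
  omega

/-- The TRS `R` viewed over the extended signature `F ⊕ F`. -/
def liftTRS (R : Set (Term F V × Term F V)) :
    Set (Term (F ⊕ F) V × Term (F ⊕ F) V) :=
  { p | ∃ l r, (l, r) ∈ R ∧ p = (l.lift, r.lift) }

/-- The defined symbols of `R`: root symbols of left-hand sides. -/
def DefinedSym (R : Set (Term F V × Term F V)) : Set F :=
  { f | ∃ ts r, (Term.app f ts, r) ∈ R }

/-- `t#`: the term `f(t₁,…,tₙ)` with its root replaced by the tuple symbol `f#`. -/
def Term.sharp : Term F V → Term (F ⊕ F) V
  | .var x => .var x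
  | .app f ts => .app (Sum.inr f) (ts.attach.map fun t => t.1.lift)

/-- The set of dependency pairs of `R`: rules `ℓ# → t#` where `ℓ → r ∈ R` and
`t` is a subterm of `r` whose root symbol is defined. -/
def DP (R : Set (Term F V × Term F V)) :
    Set (Term (F ⊕ F) V × Term (F ⊕ F) V) :=
  { p | ∃ l r t, (l, r) ∈ R ∧ Sub t r ∧
        (∃ g ts, t = Term.app g ts ∧ g ∈ DefinedSym R) ∧
        p = (l.sharp, t.sharp) }

/-- There is an infinite minimal `(P,R)`-chain
`t₀ →_{>ε,R}* s₀ →_{ε,P} t₁ →_{>ε,R}* s₁ →_{ε,P} t₂ ⋯` (all proper subterms of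
the `tᵢ` are terminating w.r.t. `R`). -/
def InfMinChain (P R : Set (Term F V × Term F V)) : Prop :=
  ∃ t s : ℕ → Term F V,
    (∀ i, Relation.ReflTransGen (BelowRew R) (t i) (s i)) ∧
    (∀ i, RootStep P (s i) (t (i + 1))) ∧
    (∀ i v, PSub v (t i) → Terminating R v)

/-- There is an infinite innermost minimal `(P,R)`-chain: as above, where the
below-root `R`-steps are innermost and each root `P`-step is applied to a term
all of whose proper subterms are normal forms of `R`. -/
def InfInnMinChain (P R : Set (Term F V × Term F V)) : Prop :=
  ∃ t s : ℕ → Term F V,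
    (∀ i, Relation.ReflTransGen (IBelowRew R) (t i) (s i)) ∧
    (∀ i v, PSub v (s i) → NormalForm R v) ∧
    (∀ i, RootStep P (s i) (t (i + 1))) ∧
    (∀ i v, PSub v (t i) → Terminating R v)

/-- Finite minimal `(P,R)`-chains of length `n` (number of root `P`-steps),
from the first term to the term reached right after the `n`-th root `P`-step. -/
inductive MinChainN (P R : Set (Term F V × Term F V)) :
    ℕ → Term F V → Term F V → Prop
  | refl {t : Term F V} :
      (∀ v, PSub v t → Terminating R v) → MinChainN P R 0 t t
  | step {n : ℕ} {t₀ t s t' : Term F V} :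
      MinChainN P R n t₀ t →
      Relation.ReflTransGen (BelowRew R) t s →
      RootStep P s t' →
      (∀ v, PSub v t' → Terminating R v) →
      MinChainN P R (n + 1) t₀ t'

/-- Finite innermost minimal `(P,R)`-chains of length `n`. -/
inductive InnMinChainN (P R : Set (Term F V × Term F V)) :
    ℕ → Term F V → Term F V → Prop
  | refl {t : Term F V} :
      (∀ v, PSub v t → Terminating R v) → InnMinChainN P R 0 t t
  | step {n : ℕ} {t₀ t s t' : Term F V} :
      InnMinChainN P R n t₀ t →
      Relation.ReflTransGen (IBelowRew R) t s →
      (∀ v, PSub v s → NormalForm R v) →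
      RootStep P s t' →
      (∀ v, PSub v t' → Terminating R v) →
      InnMinChainN P R (n + 1) t₀ t'

end RWS

namespace RWS

open Relation

variable {F V : Type}

theorem Term.induction {P : Term F V → Prop} (var : ∀ x, P (.var x))
    (app : ∀ f ts, (∀ t ∈ ts, P t) → P (.app f ts)) : ∀ t, P t
  | .var x => var x
  | .app f ts => app f ts fun t _ => Term.induction var app t
decreasing_by
  simp_wf
  have := List.sizeOf_lt_of_mem ‹_ ∈ _›
  omega

theorem Term.subst_var (σ : V → Term F V) (x : V) : (Term.var x).subst σ = σ x := by
  rw [Term.subst]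

theorem Term.subst_app (σ : V → Term F V) (f : F) (ts : List (Term F V)) :
    (Term.app f ts).subst σ = .app f (ts.map (Term.subst σ)) := by
  rw [Term.subst, List.attach_map_val (l := ts) (f := Term.subst σ)]

theorem Term.varOccs_app (f : F) (ts : List (Term F V)) :
    (Term.app f ts).varOccs = (ts.map Term.varOccs).flatten := by
  rw [Term.varOccs, List.attach_map_val (l := ts) (f := Term.varOccs)]

theorem Term.varOccs_var (x : V) : (Term.var x : Term F V).varOccs = [x] := by
  rw [Term.varOccs]

theorem Term.subst_congr {σ τ : V → Term F V} (t : Term F V) :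
    (∀ x ∈ t.varOccs, σ x = τ x) → t.subst σ = t.subst τ := by
  induction t using Term.induction with
  | var x => intro h; simpa [Term.subst_var] using h x (by simp [Term.varOccs_var])
  | app f ts ih =>
    intro h
    rw [Term.subst_app, Term.subst_app]
    congr 1
    refine List.map_congr_left fun t ht => ih t ht fun x hx => h x ?_
    rw [Term.varOccs_app]
    exact List.mem_flatten.2 ⟨_, List.mem_map_of_mem ht, hx⟩

/-- One-hole contexts. -/
inductive Ctx (F V : Type) : Type
  | hole : Ctx F V
  | app : F → List (Term F V) → Ctx F V → List (Term F V) → Ctx F V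

/-- Filling the hole of a context with a term. -/
def Ctx.fill : Ctx F V → Term F V → Term F V
  | .hole, t => t
  | .app f ts C us, t => .app f (ts ++ C.fill t :: us)

/-- Composition of contexts. -/
def Ctx.comp : Ctx F V → Ctx F V → Ctx F V
  | .hole, D => D
  | .app f ts C us, D => .app f ts (C.comp D) us

theorem Ctx.fill_comp (C D : Ctx F V) (t : Term F V) :
    (C.comp D).fill t = C.fill (D.fill t) := by
  induction C with
  | hole => rfl
  | app f ts C us ih => simp [Ctx.comp, Ctx.fill, ih]

/-- A linear term containing `x` is a one-hole context around `x`. -/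
theorem Term.Linear.exists_ctx [DecidableEq V] {r : Term F V} (hr : r.Linear) {x : V}
    (hx : x ∈ r.varOccs) (σ : V → Term F V) :
    ∃ E : Ctx F V, ∀ v, r.subst (Function.update σ x v) = E.fill v := by
  induction r using Term.induction with
  | var y =>
    obtain rfl : x = y := by simpa [Term.varOccs_var] using hx
    exact ⟨.hole, fun v => by simp [Term.subst_var, Ctx.fill]⟩
  | app f ts ih =>
    rw [Term.Linear, Term.varOccs_app] at hr
    rw [Term.varOccs_app] at hx
    obtain ⟨t, ht, hxt⟩ : ∃ t ∈ ts, x ∈ t.varOccs := by simpa using hx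
    obtain ⟨as, bs, rfl⟩ := List.append_of_mem ht
    rw [List.nodup_flatten, List.map_append, List.map_cons, List.pairwise_append,
      List.pairwise_cons] at hr
    obtain ⟨h1, -, ⟨h2, -⟩, h3⟩ := hr
    obtain ⟨E, hE⟩ := ih t ht (h1 _ (by simp)) hxt
    refine ⟨.app f (as.map (Term.subst σ)) E (bs.map (Term.subst σ)), fun v => ?_⟩
    have upd : ∀ a : Term F V, x ∉ a.varOccs →
        a.subst (Function.update σ x v) = a.subst σ := fun a ha =>
      Term.subst_congr a fun y hy => Function.update_of_ne (ne_of_mem_of_not_mem hy ha) _ _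
    rw [Term.subst_app, Ctx.fill, List.map_append, List.map_cons, hE]
    congr 2
    · refine List.map_congr_left fun a ha => upd a fun hxa => ?_
      exact h3 _ (List.mem_map_of_mem ha) _ (by simp) hxa hxt
    · congr 1
      refine List.map_congr_left fun b hb => upd b fun hxb => ?_
      exact h2 _ (List.mem_map_of_mem hb) hxt hxb

theorem PSub.trans {s t u : Term F V} (h₁ : PSub s t) (h₂ : PSub t u) : PSub s u := by
  induction h₂ with
  | head h => exact .tail h₁ h
  | tail _ h ih => exact .tail ih h

theorem Sub.trans_psub {s t u : Term F V} (h₁ : Sub s t) (h₂ : PSub t u) : PSub s u := by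
  rcases h₁ with rfl | h₁
  · exact h₂
  · exact h₁.trans h₂

theorem PSub.not_var {s : Term F V} {x : V} : ¬ PSub s (.var x) := nofun

theorem PSub.sub_arg {s : Term F V} {f : F} {ts : List (Term F V)} (h : PSub s (.app f ts)) :
    ∃ t ∈ ts, Sub s t := by
  cases h with
  | head h => exact ⟨_, h, .inl rfl⟩
  | tail h h' => exact ⟨_, h', .inr h⟩

theorem PSub.exists_ctx {s t : Term F V} (h : PSub s t) : ∃ C : Ctx F V, t = C.fill s := by
  induction h with
  | @head f ts h =>
    obtain ⟨as, bs, rfl⟩ := List.append_of_mem h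
    exact ⟨.app f as .hole bs, rfl⟩
  | @tail u f ts _ h ih =>
    obtain ⟨C, rfl⟩ := ih
    obtain ⟨as, bs, rfl⟩ := List.append_of_mem h
    exact ⟨.app f as C bs, rfl⟩

theorem Sub.subst_var {u : Term F V} {x : V} (σ : V → Term F V) :
    x ∈ u.varOccs → Sub (σ x) (u.subst σ) := by
  induction u using Term.induction with
  | var y =>
    intro h
    obtain rfl : x = y := by simpa [Term.varOccs_var] using h
    exact .inl (Term.subst_var σ x).symm
  | app f ts ih =>
    intro h
    obtain ⟨t, ht, hxt⟩ : ∃ t ∈ ts, x ∈ t.varOccs := by simpa [Term.varOccs_app] using h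
    rw [Term.subst_app]
    exact .inr ((ih t ht hxt).trans_psub (.head (List.mem_map_of_mem ht)))

theorem PSub.subst_var {u : Term F V} {x : V} (σ : V → Term F V) (hu : ¬ u.IsVar)
    (h : x ∈ u.varOccs) : PSub (σ x) (u.subst σ) := by
  cases u with
  | var y => exact (hu trivial).elim
  | app f ts =>
    obtain ⟨t, ht, hxt⟩ : ∃ t ∈ ts, x ∈ t.varOccs := by simpa [Term.varOccs_app] using h
    rw [Term.subst_app]
    exact (Sub.subst_var σ hxt).trans_psub (.head (List.mem_map_of_mem ht))

/-- Relations on terms closed under contexts. -/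
def CtxClosed (S : Term F V → Term F V → Prop) : Prop :=
  ∀ ⦃f ts us s t⦄, S s t → S (.app f (ts ++ s :: us)) (.app f (ts ++ t :: us))

variable {S : Term F V → Term F V → Prop}

theorem CtxClosed.fill (hS : CtxClosed S) {s t : Term F V} (h : S s t) (C : Ctx F V) :
    S (C.fill s) (C.fill t) := by
  induction C with
  | hole => exact h
  | app f ts C us ih => exact hS ih

theorem CtxClosed.reflTransGen (hS : CtxClosed S) : CtxClosed (ReflTransGen S) :=
  fun f ts us _ _ h => h.lift (fun a => Term.app f (ts ++ a :: us)) fun _ _ h => hS h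

theorem CtxClosed.transGen (hS : CtxClosed S) : CtxClosed (TransGen S) :=
  fun f ts us _ _ h => h.lift (fun a => Term.app f (ts ++ a :: us)) fun _ _ h => hS h

theorem CtxClosed.app_args (hS : CtxClosed S) {f : F} {ts us : List (Term F V)}
    (h : List.Forall₂ (ReflTransGen S) ts us) (pre : List (Term F V)) :
    ReflTransGen S (.app f (pre ++ ts)) (.app f (pre ++ us)) := by
  induction h generalizing pre with
  | nil => exact .refl
  | @cons a b as bs hab _ ih =>
    refine (hS.reflTransGen hab).trans ?_
    simpa using ih (pre ++ [b])

theorem CtxClosed.subst (hS : CtxClosed S) {σ τ : V → Term F V}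
    (h : ∀ x, ReflTransGen S (σ x) (τ x)) (t : Term F V) :
    ReflTransGen S (t.subst σ) (t.subst τ) := by
  induction t using Term.induction with
  | var x => simpa [Term.subst_var] using h x
  | app f ts ih =>
    rw [Term.subst_app, Term.subst_app]
    refine hS.app_args (pre := []) ?_
    rw [List.forall₂_map_left_iff, List.forall₂_map_right_iff, List.forall₂_same]
    exact ih

theorem CtxClosed.fill_subst (hS : CtxClosed S) {σ τ : V → Term F V}
    (h : ∀ x, ReflTransGen S (σ x) (τ x)) {f : F} {as bs : List (Term F V)}
    {s t : Term F V} (hst : ReflTransGen S s (t.subst τ)) :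
    ReflTransGen S (.app f (as.map (Term.subst σ) ++ s :: bs.map (Term.subst σ)))
      ((Term.app f (as ++ t :: bs)).subst τ) := by
  rw [Term.subst_app, List.map_append, List.map_cons]
  have key : ∀ cs : List (Term F V),
      List.Forall₂ (ReflTransGen S) (cs.map (Term.subst σ)) (cs.map (Term.subst τ)) := by
    intro cs
    rw [List.forall₂_map_left_iff, List.forall₂_map_right_iff, List.forall₂_same]
    exact fun c _ => hS.subst h c
  exact hS.app_args (pre := []) (List.rel_append (key as) (.cons hst (key bs)))

/-- `S`-successors together with proper subterms. -/
def SuccOrPSub (S : Term F V → Term F V → Prop) (a b : Term F V) : Prop := S b a ∨ PSub a b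

theorem transGen_succOrPSub {s t : Term F V} (h : TransGen S s t) :
    TransGen (SuccOrPSub S) t s := by
  induction h with
  | single h => exact .single (.inl h)
  | tail _ h ih => exact .head (.inl h) ih

theorem CtxClosed.acc_succOrPSub (hS : CtxClosed S) {s : Term F V}
    (hs : Acc (fun a b => S b a) s) : Acc (SuccOrPSub S) s := by
  suffices ∀ u, Sub u s → Acc (SuccOrPSub S) u from this s (.inl rfl)
  induction hs with
  | intro s _ ih =>
    intro u
    have succ : ∀ u v, Sub u s → S u v → Acc (SuccOrPSub S) v := by
      rintro u v (rfl | hu) huv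
      · exact ih v huv v (.inl rfl)
      · obtain ⟨C, rfl⟩ := hu.exists_ctx
        refine ih _ (hS.fill huv C) v ?_
        clear * -
        cases C with
        | hole => exact .inl rfl
        | app f ts C us =>
          right
          induction C generalizing f ts us with
          | hole => exact .head (by simp [Ctx.fill])
          | app g ts' C us' ihC => exact (ihC g ts' us').tail (by simp [Ctx.fill])
    induction u using Term.induction with
    | var x =>
      intro hu
      exact ⟨_, fun v hv => hv.elim (succ _ v hu) fun h => (PSub.not_var h).elim⟩
    | app f ts ihu =>
      intro hu
      have arg : ∀ t ∈ ts, Acc (SuccOrPSub S) t := fun t ht => by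
        refine ihu t ht (.inr ?_)
        rcases hu with rfl | hu
        · exact .head ht
        · exact (PSub.head ht).trans hu
      refine ⟨_, fun v hv => hv.elim (succ _ v hu) fun h => ?_⟩
      obtain ⟨t, ht, rfl | hvt⟩ := h.sub_arg
      · exact arg _ ht
      · exact (arg t ht).inv (.inr hvt)

variable {R : Set (Term F V × Term F V)}

/-- Strong normalization as accessibility. -/
def SN (R : Set (Term F V × Term F V)) (t : Term F V) : Prop := Acc (fun a b => Rew R b a) t

theorem rew_ctxClosed : CtxClosed (Rew R) := fun _ _ _ _ _ h => .congr h

theorem irew_ctxClosed : CtxClosed (IRew R) := fun _ _ _ _ _ h => .congr h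

theorem IRew.rew {s t : Term F V} (h : IRew R s t) : Rew R s t := by
  induction h with
  | root h _ => exact .root h
  | congr _ ih => exact .congr ih

theorem SN.of_reflTransGen {s t : Term F V} (hs : SN R s) (h : ReflTransGen (Rew R) s t) :
    SN R t := by
  induction h with
  | refl => exact hs
  | tail _ h ih => exact ih.inv h

theorem SN.exists_normalForm {s : Term F V} (hs : SN R s) :
    ∃ t, ReflTransGen (Rew R) s t ∧ NormalForm R t := by
  induction hs with
  | intro s _ ih =>
    by_cases h : NormalForm R s
    · exact ⟨s, .refl, h⟩
    · simp only [NormalForm, not_forall, not_not] at h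
      obtain ⟨u, hu⟩ := h
      obtain ⟨t, ht, hnf⟩ := ih u hu
      exact ⟨t, .head hu ht, hnf⟩

theorem NormalForm.eq_of_reflTransGen {s t : Term F V} (hs : NormalForm R s)
    (h : ReflTransGen (Rew R) s t) : t = s := by
  rcases h.cases_head with h | ⟨u, hu, -⟩
  · exact h.symm
  · exact (hs u hu).elim

theorem Rew.app_cases {f : F} {ts : List (Term F V)} {w : Term F V}
    (h : Rew R (.app f ts) w) :
    RootStep R (.app f ts) w ∨
      ∃ as a b bs, ts = as ++ a :: bs ∧ Rew R a b ∧ w = .app f (as ++ b :: bs) := by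
  generalize hs : Term.app f ts = s at h
  cases h with
  | root h => exact .inl ⟨_, _, _, h, rfl, rfl⟩
  | congr h =>
    injection hs with h₁ h₂
    subst h₁ h₂
    exact .inr ⟨_, _, _, _, rfl, h, rfl⟩

theorem rootStep_irew {s t : Term F V} (h : RootStep R s t)
    (hs : ∀ u, PSub u s → NormalForm R u) : IRew R s t := by
  obtain ⟨l, r, σ, hlr, rfl, rfl⟩ := h
  exact .root hlr hs

theorem normalForm_var (hTRS : IsTRS R) (x : V) : NormalForm R (.var x) := by
  intro u hu
  generalize hs : Term.var x = s at hu
  cases hu with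
  | @root l r σ h =>
    have := (hTRS _ h).1
    cases l with
    | var y => exact this trivial
    | app f ts => rw [Term.subst_app] at hs; cases hs
  | congr => cases hs

theorem NormalForm.of_psub {s t : Term F V} (ht : NormalForm R t) (h : PSub s t) :
    NormalForm R s := by
  intro u hu
  obtain ⟨C, rfl⟩ := h.exists_ctx
  exact ht _ (rew_ctxClosed.fill hu C)

theorem IRew.of_rew_app {f : F} {ts : List (Term F V)} {w : Term F V}
    (hts : ∀ t ∈ ts, NormalForm R t) (h : Rew R (.app f ts) w) : IRew R (.app f ts) w := by
  rcases h.app_cases with h | ⟨as, a, b, bs, rfl, hab, -⟩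
  · refine rootStep_irew h fun u hu => ?_
    obtain ⟨t, ht, rfl | hut⟩ := hu.sub_arg
    · exact hts _ ht
    · exact (hts t ht).of_psub hut
  · exact (hts a (by simp) b hab).elim

/-- An instance by normal forms of a term that overlaps no left-hand side is a normal form. -/
theorem normalForm_subst {u : Term F V} {σ : V → Term F V}
    (hu : ∀ v, Sub v u → ¬ v.IsVar → ∀ l r τ, (l, r) ∈ R → v.subst σ ≠ l.subst τ)
    (hσ : ∀ x ∈ u.varOccs, NormalForm R (σ x)) : NormalForm R (u.subst σ) := by
  induction u using Term.induction with
  | var x => simpa [Term.subst_var] using hσ x (by simp [Term.varOccs_var])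
  | app f ts ih =>
    intro w hw
    have hroot := hu (.app f ts) (.inl rfl) id
    rw [Term.subst_app] at hw hroot
    rcases hw.app_cases with ⟨l, r, τ, hlr, h, -⟩ | ⟨as, a, b, bs, hts, hab, -⟩
    · exact hroot l r τ hlr h
    · have ha : a ∈ ts.map (Term.subst σ) := by simp [hts]
      obtain ⟨t, ht, rfl⟩ := List.mem_map.1 ha
      refine ih t ht (fun v hv => hu v (.inr (hv.trans_psub (.head ht)))) (fun x hx => hσ x ?_)
        b hab
      rw [Term.varOccs_app]
      exact List.mem_flatten.2 ⟨_, List.mem_map_of_mem ht, hx⟩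

/-- A subterm occurrence in an instance `l.subst σ` lies either at a non-variable position of `l`
or inside the substitution part. -/
theorem subst_eq_fill_cases [DecidableEq V] {σ : V → Term F V} {s : Term F V} (l : Term F V) :
    ∀ C : Ctx F V, l.subst σ = C.fill s →
    (∃ u, ¬ u.IsVar ∧ Sub u l ∧ (C ≠ .hole → PSub u l) ∧ s = u.subst σ ∧
      ∀ τ : V → Term F V, (∀ x, ReflTransGen (Rew R) (σ x) (τ x)) →
        ReflTransGen (Rew R) (C.fill (u.subst τ)) (l.subst τ)) ∨
    ∃ x D, σ x = Ctx.fill D s ∧ ∀ s', ReflTransGen (Rew R) s s' →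
      ReflTransGen (Rew R) (C.fill s') (l.subst (Function.update σ x (D.fill s'))) := by
  induction l using Term.induction with
  | var x =>
    intro C h
    rw [Term.subst_var] at h
    exact .inr ⟨x, C, h, fun s' _ => by simp [Term.subst_var, ReflTransGen.refl]⟩
  | app f ls ih =>
    intro C h
    cases C with
    | hole => exact .inl ⟨.app f ls, id, .inl rfl, fun h => (h rfl).elim, h.symm, fun _ _ => .refl⟩
    | app g ts C us =>
      rw [Term.subst_app, Ctx.fill] at h
      injection h with h₁ h₂
      subst h₁
      obtain ⟨as, bs', rfl, rfl, h₃⟩ := List.map_eq_append_iff.1 h₂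
      obtain ⟨l, bs, rfl, h₄, rfl⟩ := List.map_eq_cons_iff.1 h₃
      rcases ih l (by simp) C h₄ with ⟨u, hu, hul, -, rfl, hτ⟩ | ⟨x, D, hD, hs⟩
      · have hp : PSub u (.app f (as ++ l :: bs)) := hul.trans_psub (.head (by simp))
        refine .inl ⟨u, hu, .inr hp, fun _ => hp, rfl, fun τ h => ?_⟩
        exact rew_ctxClosed.fill_subst h (hτ τ h)
      · refine .inr ⟨x, D, hD, fun s' hs' => ?_⟩
        refine rew_ctxClosed.fill_subst (fun y => ?_) (hs s' hs')
        rcases eq_or_ne y x with rfl | hy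
        · rw [Function.update_self, hD]
          clear hs hD h₄
          induction D with
          | hole => exact hs'
          | app _ _ _ _ ihD => exact rew_ctxClosed.reflTransGen ihD
        · rw [Function.update_of_ne hy]

/-- The ways a rewrite step from `C.fill s` can interact with the occurrence `s`: it takes place
inside `s`, it moves `s` along, it erases `s`, or it matches a non-variable part of a left-hand
side against `s`. -/
theorem Rew.fill_cases [DecidableEq V] (hRL : RightLinear R) (hOV : Overlay R)
    {s : Term F V} (C : Ctx F V) : ∀ w, Rew R (C.fill s) w →
    (∃ s', Rew R s s' ∧ w = C.fill s') ∨
    (∃ D : Ctx F V, w = D.fill s ∧ ∀ s', ReflTransGen (Rew R) s s' →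
      TransGen (Rew R) (C.fill s') (D.fill s')) ∨
    (∀ s', ReflTransGen (Rew R) s s' → TransGen (Rew R) (C.fill s') w) ∨
    ∃ (D : Ctx F V) (u r : Term F V) (σ : V → Term F V), ¬ u.IsVar ∧ s = u.subst σ ∧
      r.Linear ∧ w = D.fill (r.subst σ) ∧
      (∀ τ : V → Term F V, (∀ x ∈ u.varOccs, NormalForm R (τ x)) → NormalForm R (u.subst τ)) ∧
      ∀ τ : V → Term F V, (∀ x, ReflTransGen (Rew R) (σ x) (τ x)) →
        TransGen (Rew R) (C.fill (u.subst τ)) (D.fill (r.subst τ)) := by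
  induction C with
  | hole => exact fun w h => .inl ⟨w, h, rfl⟩
  | app f ts C us ih =>
    intro w h
    rcases Rew.app_cases h with ⟨l, r, σ, hlr, hl, rfl⟩ | ⟨as, a, b, bs, heq, hab, rfl⟩
    · rcases subst_eq_fill_cases (R := R) l (.app f ts C us) hl.symm with
        ⟨u, hu, -, hul, rfl, hτ⟩ | ⟨x, D, hD, hs⟩
      · have hul := hul (by simp)
        refine .inr (.inr (.inr ⟨.hole, u, r, σ, hu, rfl, hRL _ hlr, rfl, fun τ hnf => ?_,
          fun τ h => .tail' (hτ τ h) (.root hlr)⟩))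
        refine normalForm_subst (fun v hv hvar l' r' τ' hlr' heq => ?_) hnf
        exact hOV ⟨l, r, l', r', v, hlr, hlr', hv.trans_psub hul, hvar, τ, τ', heq⟩
      · by_cases hx : x ∈ r.varOccs
        · obtain ⟨E, hE⟩ := Term.Linear.exists_ctx (hRL _ hlr) hx σ
          refine .inr (.inl ⟨E.comp D, ?_, fun s' hs' => ?_⟩)
          · rw [Ctx.fill_comp, ← hE, ← hD, Function.update_eq_self]
          · rw [Ctx.fill_comp, ← hE]
            exact .tail' (hs s' hs') (.root hlr)
        · refine .inr (.inr (.inl fun s' hs' => ?_))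
          rw [Term.subst_congr (τ := Function.update σ x (D.fill s')) r fun y hy =>
            (Function.update_of_ne (ne_of_mem_of_not_mem hy hx) _ _).symm]
          exact .tail' (hs s' hs') (.root hlr)
    · clear h
      rcases List.append_eq_append_iff.1 heq with ⟨cs, rfl, h⟩ | ⟨cs, rfl, h⟩
      · cases cs with
        | nil =>
          simp only [List.nil_append, List.cons.injEq] at h
          obtain ⟨rfl, rfl⟩ := h
          rw [List.append_nil]
          rcases ih b hab with ⟨s', hs', rfl⟩ | ⟨D, rfl, hD⟩ | hw |
            ⟨D, u, r, σ, hu, hs, hr, rfl, hnf, hτ⟩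
          · exact .inl ⟨s', hs', rfl⟩
          · exact .inr (.inl ⟨.app f ts D us, rfl, fun s' hs' =>
              rew_ctxClosed.transGen (hD s' hs')⟩)
          · exact .inr (.inr (.inl fun s' hs' => rew_ctxClosed.transGen (hw s' hs')))
          · exact .inr (.inr (.inr ⟨.app f ts D us, u, r, σ, hu, hs, hr, rfl, hnf,
              fun τ h => rew_ctxClosed.transGen (hτ τ h)⟩))
        | cons c cs =>
          simp only [List.cons_append, List.cons.injEq] at h
          obtain ⟨rfl, rfl⟩ := h
          refine .inr (.inl ⟨.app f ts C (cs ++ b :: bs), by simp [Ctx.fill], fun s' _ => ?_⟩)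
          have := Rew.congr (f := f) (ts := ts ++ C.fill s' :: cs) (us := bs) hab
          exact .single (by simpa [Ctx.fill] using this)
      · cases cs with
        | nil =>
          simp only [List.nil_append, List.cons.injEq] at h
          obtain ⟨rfl, rfl⟩ := h
          rw [List.append_nil] at *
          rcases ih b hab with ⟨s', hs', rfl⟩ | ⟨D, rfl, hD⟩ | hw |
            ⟨D, u, r, σ, hu, hs, hr, rfl, hnf, hτ⟩
          · exact .inl ⟨s', hs', rfl⟩
          · exact .inr (.inl ⟨.app f as D bs, rfl, fun s' hs' =>
              rew_ctxClosed.transGen (hD s' hs')⟩)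
          · exact .inr (.inr (.inl fun s' hs' => rew_ctxClosed.transGen (hw s' hs')))
          · exact .inr (.inr (.inr ⟨.app f as D bs, u, r, σ, hu, hs, hr, rfl, hnf,
              fun τ h => rew_ctxClosed.transGen (hτ τ h)⟩))
        | cons c cs =>
          simp only [List.cons_append, List.cons.injEq] at h
          obtain ⟨rfl, rfl⟩ := h
          refine .inr (.inl ⟨.app f (as ++ b :: cs) C us, by simp [Ctx.fill], fun s' _ => ?_⟩)
          have := Rew.congr (f := f) (ts := as) (us := cs ++ C.fill s' :: us) hab
          exact .single (by simpa [Ctx.fill] using this)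

/-- `G` holds of `C.fill s` as soon as it holds of `C.fill s'` for all normal forms `s'` of `s`. -/
def NormalizableIn (R : Set (Term F V × Term F V)) (G : Term F V → Prop) (s : Term F V) : Prop :=
  ∀ C : Ctx F V, (∀ s', ReflTransGen (Rew R) s s' → NormalForm R s' → G (C.fill s')) →
    G (C.fill s)

variable {G : Term F V → Prop}

theorem NormalizableIn.fill_subst [DecidableEq V] {r : Term F V} (hr : r.Linear) (D : Ctx F V)
    (xs : List V) (σ : V → Term F V) (hxs : ∀ x ∈ xs, NormalizableIn R G (σ x))
    (hnf : ∀ x ∈ xs, ∃ t, ReflTransGen (Rew R) (σ x) t ∧ NormalForm R t)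
    (h : ∀ τ : V → Term F V, (∀ x, ReflTransGen (Rew R) (σ x) (τ x)) →
      (∀ x ∈ xs, NormalForm R (τ x)) → G (D.fill (r.subst τ))) :
    G (D.fill (r.subst σ)) := by
  induction xs generalizing σ with
  | nil => exact h σ (fun _ => .refl) (by simp)
  | cons x xs ih =>
    have key : ∀ v, ReflTransGen (Rew R) (σ x) v → NormalForm R v →
        G (D.fill (r.subst (Function.update σ x v))) := by
      intro v hv hvnf
      refine ih _ (fun y hy => ?_) (fun y hy => ?_) fun τ hτ hτnf => h τ (fun y => ?_) ?_
      · rcases eq_or_ne y x with rfl | hyx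
        · rw [Function.update_self]
          exact fun C hC => hC v .refl hvnf
        · rw [Function.update_of_ne hyx]
          exact hxs y (List.mem_cons_of_mem _ hy)
      · rcases eq_or_ne y x with rfl | hyx
        · rw [Function.update_self]
          exact ⟨v, .refl, hvnf⟩
        · rw [Function.update_of_ne hyx]
          exact hnf y (List.mem_cons_of_mem _ hy)
      · rcases eq_or_ne y x with rfl | hyx
        · have := hτ y
          rw [Function.update_self] at this
          exact hv.trans this
        · have := hτ y
          rwa [Function.update_of_ne hyx] at this
      · intro y hy
        rcases List.mem_cons.1 hy with rfl | hy
        · have := hτ y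
          rw [Function.update_self] at this
          rwa [hvnf.eq_of_reflTransGen this]
        · exact hτnf y hy
    by_cases hx : x ∈ r.varOccs
    · obtain ⟨E, hE⟩ := hr.exists_ctx hx σ
      have := hxs x (by simp) (D.comp E) fun v hv hvnf => by
        rw [Ctx.fill_comp, ← hE]
        exact key v hv hvnf
      rwa [Ctx.fill_comp, ← hE, Function.update_eq_self] at this
    · obtain ⟨v, hv, hvnf⟩ := hnf x (by simp)
      have := key v hv hvnf
      rwa [Term.subst_congr (τ := σ) r fun y hy =>
        Function.update_of_ne (ne_of_mem_of_not_mem hy hx) _ _] at this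

/-- Strongly normalizing subterms may be normalized first, for suitable properties `G`. -/
theorem SN.normalizableIn (hRL : RightLinear R) (hOV : Overlay R)
    (hstep : ∀ s t, G s → Rew R s t → G t) (hSN : ∀ s, G s → SN R s)
    (hG : ∀ s, ¬ NormalForm R s → (∀ t, Rew R s t → G t) → G s)
    {s : Term F V} (hs : SN R s) : NormalizableIn R G s := by
  classical
  have htrans : ∀ s t, G s → TransGen (Rew R) s t → G t := by
    intro s t hGs h
    induction h with
    | single h => exact hstep _ _ hGs h
    | tail _ h ih => exact hstep _ _ ih h
  induction rew_ctxClosed.acc_succOrPSub hs with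
  | intro s hacc ih =>
    have subSN : ∀ t, SuccOrPSub (Rew R) t s → SN R t := fun t ht =>
      Subrelation.accessible (fun h => Or.inl h) (hacc t ht)
    obtain ⟨s₀, hs₀, hnf₀⟩ := hs.exists_normalForm
    intro C hC
    have hC₀ := (hSN _ (hC s₀ hs₀ hnf₀)).transGen
    generalize hv : C.fill s₀ = v at hC₀
    induction hC₀ generalizing C with
    | intro v _ ihv =>
      subst hv
      by_cases hnf : NormalForm R s
      · exact hC s .refl hnf
      refine hG _ (fun h => hnf fun t ht => h _ (rew_ctxClosed.fill ht C)) fun w hw => ?_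
      rcases hw.fill_cases hRL hOV with ⟨s', hs', rfl⟩ | ⟨D, rfl, hD⟩ | hw |
        ⟨D, u, r, σ, hu, rfl, hr, rfl, hunf, hτ⟩
      · exact ih s' (.inl hs') (subSN _ (.inl hs')) C fun t ht => hC t (.head hs' ht)
      · refine ihv (D.fill s₀) (transGen_swap.1 (hD s₀ hs₀)) D (fun s' hs' hnf' => ?_) rfl
        exact htrans _ _ (hC s' hs' hnf') (hD s' hs')
      · exact htrans _ _ (hC s₀ hs₀ hnf₀) (hw s₀ hs₀)
      · have hsub : ∀ x ∈ u.varOccs, SuccOrPSub (Rew R) (σ x) (u.subst σ) := fun x hx =>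
          .inr (PSub.subst_var σ hu hx)
        refine NormalizableIn.fill_subst hr D u.varOccs σ
          (fun x hx => ih _ (hsub x hx) (subSN _ (hsub x hx)))
          (fun x hx => (subSN _ (hsub x hx)).exists_normalForm) fun τ h hnfτ => ?_
        exact htrans _ _ (hC _ (rew_ctxClosed.subst h u) (hunf τ hnfτ)) (hτ τ h)

theorem NormalizableIn.app_args {f : F} {ts : List (Term F V)}
    (hts : ∀ t ∈ ts, NormalizableIn R G t) (pre : List (Term F V))
    (h : ∀ us, List.Forall₂ (fun t u => ReflTransGen (Rew R) t u ∧ NormalForm R u) ts us →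
      G (.app f (pre ++ us))) : G (.app f (pre ++ ts)) := by
  induction ts generalizing pre with
  | nil => exact h [] .nil
  | cons t ts ih =>
    refine hts t (by simp) (.app f pre .hole ts) fun t' ht' hnf => ?_
    have := ih (fun a ha => hts a (List.mem_cons_of_mem _ ha)) (pre ++ [t']) fun us hus => by
      simpa using h (t' :: us) (.cons ⟨ht', hnf⟩ hus)
    simpa [Ctx.fill] using this

theorem forall₂_right_of {α β : Type} {P : α → β → Prop} {Q : β → Prop} {as : List α}
    {bs : List β} (h : List.Forall₂ P as bs) (hPQ : ∀ a b, P a b → Q b) : ∀ b ∈ bs, Q b := by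
  induction h with
  | nil => simp
  | cons hab _ ih => simpa using ⟨hPQ _ _ hab, ih⟩

theorem forall₂_imp_of_mem {α β : Type} {P Q : α → β → Prop} {as : List α}
    {bs : List β} (h : List.Forall₂ P as bs) (hPQ : ∀ a ∈ as, ∀ b, P a b → Q a b) :
    List.Forall₂ Q as bs := by
  induction h with
  | nil => exact .nil
  | cons hab _ ih =>
    exact .cons (hPQ _ (by simp) _ hab) (ih fun a ha => hPQ a (List.mem_cons_of_mem _ ha))

/-- In right-linear overlay systems, innermost rewriting reaches every normal form of a strongly
normalizing term. -/
theorem SN.innermost_reaches (hTRS : IsTRS R) (hRL : RightLinear R) (hOV : Overlay R)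
    {s t : Term F V} (hs : SN R s) (hst : ReflTransGen (Rew R) s t) (ht : NormalForm R t) :
    ReflTransGen (IRew R) s t := by
  induction (rew_ctxClosed.acc_succOrPSub hs).transGen generalizing t with
  | intro s hacc ih =>
    have subSN : ∀ u, TransGen (SuccOrPSub (Rew R)) u s → SN R u := fun u hu =>
      Subrelation.accessible (fun h => .single (.inl h)) (hacc u hu)
    cases s with
    | var x =>
      rw [(normalForm_var hTRS x).eq_of_reflTransGen hst]
    | app f ts =>
      by_contra hcon
      refine absurd hst (And.right (a := SN R (.app f ts)) ?_)
      refine NormalizableIn.app_args (R := R) (G := fun w => SN R w ∧ ¬ ReflTransGen (Rew R) w t)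
        (pre := []) (fun a ha => ?_) fun us hus => ?_
      · refine SN.normalizableIn hRL hOV (fun a b h hab => ⟨h.1.inv hab, fun hb => h.2 (.head hab hb)⟩)
          (fun a h => h.1) (fun a hnf h => ⟨⟨_, fun b hb => (h b hb).1⟩, fun hat => ?_⟩)
          (subSN a (.single (.inr (.head ha))))
        rcases hat.cases_head with rfl | ⟨b, hab, hbt⟩
        · exact hnf ht
        · exact (h b hab).2 hbt
      · have hred : ReflTransGen (Rew R) (.app f ts) (.app f us) :=
          rew_ctxClosed.app_args (hus.imp fun _ _ h => h.1) []
        have hired : ReflTransGen (IRew R) (.app f ts) (.app f us) := by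
          refine irew_ctxClosed.app_args (pre := []) (forall₂_imp_of_mem hus fun a ha b hab => ?_)
          have hlt : TransGen (SuccOrPSub (Rew R)) a (.app f ts) := .single (.inr (.head ha))
          exact ih a hlt (subSN a hlt) hab.1 hab.2
        refine ⟨hs.of_reflTransGen hred, fun hut => hcon ?_⟩
        rcases hut.cases_head with rfl | ⟨w, huw, hwt⟩
        · exact hired
        · have hlt : TransGen (SuccOrPSub (Rew R)) w (.app f ts) := by
            exact transGen_succOrPSub (TransGen.tail' hred huw)
          refine (hired.tail (IRew.of_rew_app ?_ huw)).trans (ih w hlt (subSN w hlt) hwt ht)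
          exact forall₂_right_of hus fun _ _ h => h.2

theorem SN.of_innermost (hTRS : IsTRS R) (hRL : RightLinear R) (hOV : Overlay R)
    {s : Term F V} (hs : Acc (fun a b => IRew R b a) s) : SN R s := by
  induction (irew_ctxClosed.acc_succOrPSub hs).transGen with
  | intro s hacc ih =>
    have ih' : ∀ u, TransGen (SuccOrPSub (IRew R)) u s → SN R u := fun u hu =>
      ih u hu (Subrelation.accessible (fun h => .single (.inl h)) (hacc u hu))
    cases s with
    | var x => exact ⟨_, fun u hu => (normalForm_var hTRS x u hu).elim⟩
    | app f ts =>
      have argSN : ∀ t ∈ ts, SN R t := fun t ht => ih' t (.single (.inr (.head ht)))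
      refine NormalizableIn.app_args (R := R) (pre := []) (fun t ht => SN.normalizableIn hRL hOV
        (fun _ _ h hab => h.inv hab) (fun _ h => h) (fun _ _ h => ⟨_, h⟩) (argSN t ht))
        fun us hus => ⟨_, fun w hw => ih' w ?_⟩
      have hired : ReflTransGen (IRew R) (.app f ts) (.app f us) :=
        irew_ctxClosed.app_args (pre := []) (forall₂_imp_of_mem hus fun t ht u h =>
          (argSN t ht).innermost_reaches hTRS hRL hOV h.1 h.2)
      have huw := IRew.of_rew_app (forall₂_right_of hus fun _ _ h => h.2) hw
      exact transGen_succOrPSub (TransGen.tail' hired huw)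

/-- A right-linear overlay TRS is terminating iff it is
innermost terminating. -/
theorem terminating_iff_innermostTerminating_of_rightLinear_overlay
    {F V : Type} {R : Set (Term F V × Term F V)}
    (hTRS : IsTRS R) (hRL : RightLinear R) (hOV : Overlay R) :
    TerminatingTRS R ↔ InnermostTerminatingTRS R := by
  constructor
  · rintro h ⟨f, hf⟩
    exact h ⟨f, fun n => (hf n).rew⟩
  · rintro h ⟨f, hf⟩
    have hwf : WellFounded fun a b => IRew R b a :=
      wellFounded_iff_isEmpty_descending_chain.2 ⟨fun g => h ⟨g.1, g.2⟩⟩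
    have hsn : WellFounded fun a b => Rew R b a :=
      ⟨fun s => SN.of_innermost hTRS hRL hOV (hwf.apply s)⟩
    exact (wellFounded_iff_isEmpty_descending_chain.1 hsn).false ⟨f, hf⟩

end RWS
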